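/- For μ-almost every x ∈ (0,1), the Fibonacci exponent of x exists and equals Λ − H_μ: lim_{n→∞} (1/n)·log_λ f(ε_1(x),…,ε_n(x)) = Λ − H_μ, where H_μ = lim_{n→∞} H^{(n)}/n (this limit exists) and Λ = log_λ 2. -/

import Mathlib

open MeasureTheory Filter Topology
open scoped ENNReal

/-- The golden ratio λ = (1+√5)/2. -/
noncomputable def gold : ℝ := (1 + Real.sqrt 5) / 2

/-- `p` is the Bernoulli (1/2,1/2) product measure on `{0,1}^ℕ`, characterized by its
values on cylinder sets. -/
def IsCoinMeasure (p : Measure (ℕ → Bool)) : Prop :=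
  ∀ (s : Finset ℕ) (b : ℕ → Bool), p {ε | ∀ i ∈ s, ε i = b i} = (2 : ℝ≥0∞)⁻¹ ^ s.card

/-- π(ε) = Σ_{k=1}^∞ ε_k λ^{-k-1} (indices shifted so that `ε k` is `ε_{k+1}`). -/
noncomputable def piMap (ε : ℕ → Bool) : ℝ := ∑' k : ℕ, if ε k then gold⁻¹ ^ (k + 2) else 0

/-- The Erdős measure: the pushforward of the coin measure `p` under `piMap`. -/
noncomputable def erdosOf (p : Measure (ℕ → Bool)) : Measure ℝ := p.map piMap
/-- The value Σ_{j=1}^ℓ w_j λ^{-j} of a 0-1 word `(w_1, …, w_ℓ)`. -/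
noncomputable def wordVal : List Bool → ℝ
  | [] => 0
  | b :: t => ((if b then 1 else 0) + wordVal t) / gold

/-- `wordF w` is the number of 0-1 words of the same length as `w` having the same
value as `w`. -/
noncomputable def wordF (w : List Bool) : ℕ :=
  Nat.card {v : List Bool // v.length = w.length ∧ wordVal v = wordVal w}

/-- The block `B(a_1, …, a_t)`: the 0-1 word `1(00)^{a_1}(01)^{a_2}⋯(00)^{a_t}` if `t`
is odd and `1(01)^{a_1}(00)^{a_2}⋯(00)^{a_t}` if `t` is even (`1 = true`, `0 = false`);
the `i`-th group is `(00)^{a_i}` when `i ≡ t (mod 2)` and `(01)^{a_i}` otherwise. -/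
def blockWord (a : List ℕ) : List Bool :=
  true :: (((List.range a.length).map fun i =>
    (List.replicate (a.getD i 0)
      (if (a.length - 1 - i) % 2 = 0 then [false, false] else [false, true])).flatten).flatten)

/-- The finite continued fraction `[a_1, …, a_t] = 1/(a_1 + 1/(a_2 + ⋯ + 1/a_t))`. -/
def cf : List ℕ → ℚ
  | [] => 0
  | a :: t => 1 / ((a : ℚ) + cf t)

/-- `p + q` where `p/q = [a_1, …, a_t]` in lowest terms. -/
def pqSum (a : List ℕ) : ℕ := (cf a).num.toNat + (cf a).den


/-- The map `T x = {λ x}`. -/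
noncomputable def Tgold (x : ℝ) : ℝ := Int.fract (gold * x)

/-- The digits of the canonical (greedy) expansion: `digit k x = ⌊λ Tᵏ x⌋` is the
`(k+1)`-st digit `ε_{k+1}(x)`. -/
noncomputable def digit (k : ℕ) (x : ℝ) : ℤ := ⌊gold * Tgold^[k] x⌋

/-- The word of the first `n` digits `(ε_1(x), …, ε_n(x))` of the canonical expansion. -/
noncomputable def digitWord (n : ℕ) (x : ℝ) : List Bool :=
  (List.range n).map fun j => decide (digit j x = 1)

/-- Fibonacci numbers with the convention `F 1 = 1`, `F 2 = 2`. -/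
def fibF (n : ℕ) : ℕ := Nat.fib (n + 1)

/-- `countRep n k` is the number of tuples `(ε_1,…,ε_n) ∈ {0,1}^n` with
`k = Σ_{j=1}^n ε_j F_j`. -/
def countRep (n k : ℕ) : ℕ :=
  (Finset.univ.filter fun ε : Fin n → Bool =>
    (∑ j : Fin n, if ε j then fibF (j + 1) else 0) = k).card

/-- `H⁽ⁿ⁾ = −Σ_{k=0}^{F_{n+2}−2} (f_n(k)/2ⁿ)·log_λ(f_n(k)/2ⁿ)`. -/
noncomputable def Hent (n : ℕ) : ℝ :=
  -∑ k ∈ Finset.range (fibF (n + 2) - 1),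
      ((countRep n k : ℝ) / 2 ^ n) * Real.logb gold ((countRep n k : ℝ) / 2 ^ n)

/-! ### Coin tossing -/

section CoinMeasure

variable {p : Measure (ℕ → Bool)}

lemma IsCoinMeasure.isProbabilityMeasure (hp : IsCoinMeasure p) : IsProbabilityMeasure p :=
  ⟨by simpa using hp ∅ fun _ => false⟩

lemma IsCoinMeasure.eq_infinitePi (hp : IsCoinMeasure p) :
    p = Measure.infinitePi fun _ : ℕ => (PMF.uniformOfFintype Bool).toMeasure := by
  have := hp.isProbabilityMeasure
  refine (Measure.isProjectiveLimit_infinitePi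
    fun _ : ℕ => (PMF.uniformOfFintype Bool).toMeasure).unique (fun s => ?_) |>.symm
  refine Measure.ext_of_singleton fun b => ?_
  rw [Measure.pi_singleton, Measure.map_apply (by fun_prop) (measurableSet_singleton b)]
  have h := hp s fun i => if h : i ∈ s then b ⟨i, h⟩ else false
  have hset : (fun (ω : ℕ → Bool) (i : s) => ω i) ⁻¹' {b} =
      {ε : ℕ → Bool | ∀ i ∈ s, ε i = if h : i ∈ s then b ⟨i, h⟩ else false} := by
    ext ε
    simp only [Set.mem_preimage, Set.mem_singleton_iff, funext_iff, Subtype.forall,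
      Set.mem_ofPred_eq]
    exact forall₂_congr fun i hi => by simp [hi]
  change p ((fun (ω : ℕ → Bool) (i : s) => ω i) ⁻¹' {b}) = _
  rw [hset, h]
  simp

lemma IsCoinMeasure.unique {q : Measure (ℕ → Bool)} (hp : IsCoinMeasure p)
    (hq : IsCoinMeasure q) : p = q :=
  hp.eq_infinitePi.trans hq.eq_infinitePi.symm

lemma measurableSet_cylinder_bool (s : Finset ℕ) (b : ℕ → Bool) :
    MeasurableSet {ε : ℕ → Bool | ∀ i ∈ s, ε i = b i} := by
  have : {ε : ℕ → Bool | ∀ i ∈ s, ε i = b i} = ⋂ i ∈ s, (fun ε => ε i) ⁻¹' {b i} := by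
    ext; simp
  rw [this]
  exact Finset.measurableSet_biInter _ fun i _ =>
    measurable_pi_apply i (measurableSet_singleton _)

/-- The sequence obtained by dropping the first `n` terms. -/
def shiftSeq (n : ℕ) (ω : ℕ → Bool) : ℕ → Bool := fun k => ω (n + k)

lemma shiftSeq_zero (ω : ℕ → Bool) : shiftSeq 0 ω = ω := by
  funext k; simp [shiftSeq]

lemma shiftSeq_shiftSeq (m n : ℕ) (ω : ℕ → Bool) :
    shiftSeq m (shiftSeq n ω) = shiftSeq (n + m) ω := by
  funext k; simp [shiftSeq, add_assoc]

lemma measurable_shiftSeq (n : ℕ) : Measurable (shiftSeq n) :=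
  measurable_pi_lambda _ fun _ => measurable_pi_apply _

lemma IsCoinMeasure.measurePreserving_shiftSeq (hp : IsCoinMeasure p) (n : ℕ) :
    MeasurePreserving (shiftSeq n) p p := by
  refine ⟨measurable_shiftSeq n, IsCoinMeasure.unique (fun s b => ?_) hp⟩
  rw [Measure.map_apply (measurable_shiftSeq n) (measurableSet_cylinder_bool s b)]
  have := hp (s.map (addLeftEmbedding n)) fun i => b (i - n)
  rw [Finset.card_map] at this
  rw [← this]
  congr 1
  ext ε
  simp [shiftSeq]

lemma measurable_update_not : Measurable fun (ω : ℕ → Bool) => Function.update ω 0 (!ω 0) := by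
  refine measurable_pi_lambda _ fun i => ?_
  rcases eq_or_ne i 0 with rfl | h
  · simp only [Function.update_self]
    exact (measurable_of_countable not).comp (measurable_pi_apply (0 : ℕ))
  · simpa [Function.update_of_ne h] using measurable_pi_apply i

/-- Flipping the first coin preserves the coin measure. -/
lemma IsCoinMeasure.measurePreserving_flip (hp : IsCoinMeasure p) :
    MeasurePreserving (fun (ω : ℕ → Bool) => Function.update ω 0 (!ω 0)) p p := by
  refine ⟨measurable_update_not, IsCoinMeasure.unique (fun s b => ?_) hp⟩
  rw [Measure.map_apply measurable_update_not (measurableSet_cylinder_bool s b),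
    ← hp s (Function.update b 0 (!b 0))]
  congr 1
  ext ε
  refine forall₂_congr fun i _ => ?_
  rcases eq_or_ne i 0 with rfl | h
  · cases h : ε 0 <;> simp [h]
  · simp [Function.update_of_ne h]

lemma IsCoinMeasure.iIndepFun_eval (hp : IsCoinMeasure p) :
    ProbabilityTheory.iIndepFun (fun (i : ℕ) (ω : ℕ → Bool) => ω i) p := by
  rw [hp.eq_infinitePi]
  exact ProbabilityTheory.iIndepFun_infinitePi (X := fun _ b => b) fun _ => measurable_id

lemma measurable_prefix (m : ℕ) : Measurable fun (ω : ℕ → Bool) (i : Fin m) => ω i :=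
  measurable_pi_lambda _ fun _ => measurable_pi_apply _

lemma measurable_comp_prefix {m : ℕ} (G : (Fin m → Bool) → ℝ) :
    Measurable fun ω : ℕ → Bool => G fun i => ω i :=
  (measurable_of_countable G).comp (measurable_prefix m)

lemma integrable_comp_prefix [IsFiniteMeasure p] {m : ℕ} (G : (Fin m → Bool) → ℝ) :
    Integrable (fun ω : ℕ → Bool => G fun i => ω i) p :=
  Integrable.comp_measurable (g := G) Integrable.of_finite (measurable_prefix m)

lemma IsCoinMeasure.integral_comp_prefix (hp : IsCoinMeasure p) {m : ℕ}
    (G : (Fin m → Bool) → ℝ) :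
    ∫ ω, G (fun i => ω i) ∂p = ∑ v, G v / 2 ^ m := by
  have := hp.isProbabilityMeasure
  rw [← integral_map (f := G) (measurable_prefix m).aemeasurable
    (measurable_of_countable G).aestronglyMeasurable, integral_fintype Integrable.of_finite]
  refine Finset.sum_congr rfl fun v _ => ?_
  have h := hp (Finset.range m) fun i => if h : i < m then v ⟨i, h⟩ else false
  have hset : (fun (ω : ℕ → Bool) (i : Fin m) => ω i) ⁻¹' {v} =
      {ε : ℕ → Bool | ∀ i ∈ Finset.range m, ε i = if h : i < m then v ⟨i, h⟩ else false} := by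
    ext ε
    simp only [Set.mem_preimage, Set.mem_singleton_iff, funext_iff, Fin.forall_iff,
      Finset.mem_range, Set.mem_ofPred_eq]
    exact forall₂_congr fun i hi => by simp [hi]
  rw [measureReal_def, Measure.map_apply (measurable_prefix m) (measurableSet_singleton v),
    hset, h]
  simp [div_eq_inv_mul]

/-- The strong law of large numbers for a function of consecutive disjoint blocks of coins. -/
lemma IsCoinMeasure.strong_law_blocks (hp : IsCoinMeasure p) {m : ℕ} (G : (Fin m → Bool) → ℝ) :
    ∀ᵐ ω ∂p, Tendsto (fun n : ℕ => (∑ j ∈ Finset.range n, G fun i => ω (m * j + i)) / n) atTop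
      (𝓝 (∫ ω, G (fun i => ω i) ∂p)) := by
  have := hp.isProbabilityMeasure
  have key := ProbabilityTheory.strong_law_ae_real (μ := p)
    (fun j (ω : ℕ → Bool) => G fun i => ω (m * j + i)) ?_ ?_ ?_
  · simpa using key
  · simpa using integrable_comp_prefix G
  · intro j k hjk
    have hdis : Disjoint (Finset.Ico (m * j) (m * j + m)) (Finset.Ico (m * k) (m * k + m)) := by
      rw [Finset.disjoint_left]
      intro a ha hb
      rw [Finset.mem_Ico] at ha hb
      rcases lt_or_gt_of_ne hjk with h | h
      · have : m * (j + 1) ≤ m * k := Nat.mul_le_mul_left _ h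
        lia
      · have : m * (k + 1) ≤ m * j := Nat.mul_le_mul_left _ h
        lia
    have hI := hp.iIndepFun_eval.indepFun_finset _ _ hdis fun i => measurable_pi_apply i
    exact hI.comp
      (φ := fun v => G fun i => v ⟨m * j + i, Finset.mem_Ico.2 ⟨by lia, by lia⟩⟩)
      (ψ := fun v => G fun i => v ⟨m * k + i, Finset.mem_Ico.2 ⟨by lia, by lia⟩⟩)
      (measurable_of_countable _) (measurable_of_countable _)
  · intro j
    have h : ProbabilityTheory.IdentDistrib (shiftSeq (m * j)) id p p :=
      ⟨(measurable_shiftSeq (m * j)).aemeasurable, aemeasurable_id, by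
        rw [(hp.measurePreserving_shiftSeq (m * j)).map_eq, Measure.map_id]⟩
    simpa [Function.comp_def, shiftSeq] using h.comp (measurable_comp_prefix G)

end CoinMeasure

/-! ### A superadditive ergodic theorem for coin tossing -/

lemma tendsto_nat_div_div {m : ℕ} (hm : 0 < m) :
    Tendsto (fun n : ℕ => ((n / m : ℕ) : ℝ) / n) atTop (𝓝 (m : ℝ)⁻¹) := by
  have h := (tendsto_nat_floor_mul_div_atTop (R := ℝ) (a := (m : ℝ)⁻¹) (by positivity)).comp
    tendsto_natCast_atTop_atTop
  refine h.congr fun n => ?_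
  have : ⌊(m : ℝ)⁻¹ * n⌋₊ = n / m := by
    rw [inv_mul_eq_div, Nat.floor_div_natCast, Nat.floor_natCast]
  simp [this]

/-- Deterministic covering estimate: the orbit segment of length `m` is covered by disjoint
pieces of length at most `K` on which `a` is at least `g` times the length, up to the times
spent in the bad set `B`. -/
lemma covering_estimate {a : ℕ → (ℕ → Bool) → ℝ} {C : ℝ} {g : (ℕ → Bool) → ℝ}
    {B : Set (ℕ → Bool)} {K : ℕ}
    (hsup : ∀ m n ω, a m ω + a n (shiftSeq m ω) ≤ a (m + n) ω)
    (ha0 : ∀ n ω, 0 ≤ a n ω) (hg0 : ∀ ω, 0 ≤ g ω) (hgC : ∀ ω, g ω ≤ C)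
    (hgs : ∀ n ω, g (shiftSeq n ω) ≤ g ω)
    (hB : ∀ ω ∉ B, ∃ n, 1 ≤ n ∧ n ≤ K ∧ n * g ω ≤ a n ω) (m : ℕ) (ω : ℕ → Bool) :
    ((m : ℝ) - K) * g (shiftSeq m ω)
      - C * ∑ i ∈ Finset.range m, B.indicator 1 (shiftSeq i ω) ≤ a m ω := by
  induction m using Nat.strong_induction_on generalizing ω with
  | _ m ih =>
  have hC : 0 ≤ C := (hg0 ω).trans (hgC ω)
  have hind : ∀ ω : ℕ → Bool, (0 : ℝ) ≤ B.indicator 1 ω := fun ω =>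
    Set.indicator_nonneg (fun _ _ => zero_le_one) ω
  rcases le_or_gt m K with hmK | hmK
  · have h1 : ((m : ℝ) - K) * g (shiftSeq m ω) ≤ 0 :=
      mul_nonpos_of_nonpos_of_nonneg (by simpa using hmK) (hg0 _)
    have h2 : 0 ≤ C * ∑ i ∈ Finset.range m, B.indicator 1 (shiftSeq i ω) :=
      mul_nonneg hC (Finset.sum_nonneg fun i _ => hind _)
    linarith [ha0 m ω]
  · have step : ∀ n, 1 ≤ n → n ≤ m → ((m : ℝ) - n - K) * g (shiftSeq m ω)
        - C * ∑ i ∈ Finset.range (m - n), B.indicator 1 (shiftSeq (n + i) ω)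
          ≤ a m ω - a n ω := by
      intro n hn hnm
      have h1 := ih (m - n) (by lia) (shiftSeq n ω)
      have h2 := hsup n (m - n) ω
      simp only [shiftSeq_shiftSeq, Nat.add_sub_cancel' hnm, Nat.cast_sub hnm] at h1 h2
      linarith
    have hsum : ∀ n ≤ m, ∑ i ∈ Finset.range m, B.indicator (1 : (ℕ → Bool) → ℝ) (shiftSeq i ω)
        = ∑ i ∈ Finset.range n, B.indicator 1 (shiftSeq i ω)
          + ∑ i ∈ Finset.range (m - n), B.indicator 1 (shiftSeq (n + i) ω) := by
      intro n hnm
      rw [← Finset.sum_range_add, Nat.add_sub_cancel' hnm]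
    by_cases hω : ω ∈ B
    · have h1 := step 1 le_rfl (by lia)
      have h2 := hsum 1 (by lia)
      simp only [Finset.range_one, Finset.sum_singleton, shiftSeq_zero, Set.indicator_of_mem hω,
        Pi.one_apply] at h2
      rw [h2]
      push_cast at h1
      nlinarith [ha0 1 ω, hgC (shiftSeq m ω)]
    · obtain ⟨n, hn1, hnK, hn⟩ := hB ω hω
      have h1 := step n hn1 (by lia)
      have h2 : 0 ≤ ∑ i ∈ Finset.range n, B.indicator (1 : (ℕ → Bool) → ℝ) (shiftSeq i ω) :=
        Finset.sum_nonneg fun i _ => hind _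
      rw [hsum n (by lia)]
      have h3 : (n : ℝ) * g (shiftSeq m ω) ≤ n * g ω :=
        mul_le_mul_of_nonneg_left (hgs m ω) (Nat.cast_nonneg n)
      nlinarith [mul_nonneg hC h2]

section Superadditive

variable {p : Measure (ℕ → Bool)} {a : ℕ → (ℕ → Bool) → ℝ} {C γ : ℝ}

lemma le_of_superadditive (hsup : ∀ m n ω, a m ω + a n (shiftSeq m ω) ≤ a (m + n) ω)
    (ha0 : ∀ n ω, 0 ≤ a n ω) (m k : ℕ) (ω : ℕ → Bool) :
    ∑ j ∈ Finset.range k, a m (shiftSeq (m * j) ω) ≤ a (m * k) ω := by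
  induction k with
  | zero => simpa using ha0 0 ω
  | succ k ih =>
    rw [Finset.sum_range_succ, Nat.mul_succ]
    linarith [hsup (m * k) m ω]

lemma monotone_of_superadditive (hsup : ∀ m n ω, a m ω + a n (shiftSeq m ω) ≤ a (m + n) ω)
    (ha0 : ∀ n ω, 0 ≤ a n ω) (ω : ℕ → Bool) : Monotone fun n => a n ω :=
  monotone_nat_of_le_succ fun n => by linarith [hsup n 1 ω, ha0 1 (shiftSeq n ω)]

/-- Lower bound in the superadditive ergodic theorem. -/
lemma IsCoinMeasure.ae_eventually_lt_of_superadditive (hp : IsCoinMeasure p)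
    (hG : ∀ n, ∃ G : (Fin n → Bool) → ℝ, ∀ ω, a n ω = G fun i => ω i)
    (hsup : ∀ m n ω, a m ω + a n (shiftSeq m ω) ≤ a (m + n) ω)
    (ha0 : ∀ n ω, 0 ≤ a n ω)
    (hγ : Tendsto (fun n : ℕ => (∫ ω, a n ω ∂p) / n) atTop (𝓝 γ)) :
    ∀ᵐ ω ∂p, ∀ b < γ, ∀ᶠ n : ℕ in atTop, b < a n ω / n := by
  have key : ∀ m : ℕ, 0 < m → ∀ᵐ ω ∂p, ∀ b < (∫ ω, a m ω ∂p) / m,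
      ∀ᶠ n : ℕ in atTop, b < a n ω / n := by
    intro m hm
    obtain ⟨G, hG⟩ := hG m
    filter_upwards [hp.strong_law_blocks G] with ω hω b hb
    have h1 : Tendsto (fun n : ℕ => n / m) atTop atTop :=
      Nat.tendsto_div_const_atTop hm.ne'
    have h2 := (hω.comp h1).mul (tendsto_nat_div_div hm)
    simp only [← hG, ← div_eq_mul_inv] at h2
    filter_upwards [h2.eventually_const_lt hb, eventually_ge_atTop m] with n hn hnm
    refine hn.trans_le ?_
    have hpos : (0 : ℝ) < (n / m : ℕ) := by exact_mod_cast Nat.div_pos hnm hm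
    have h3 := le_of_superadditive hsup ha0 m (n / m) ω
    have h4 := monotone_of_superadditive hsup ha0 ω (Nat.mul_div_le n m)
    simp only [Function.comp_apply]
    rw [div_mul_div_cancel₀ hpos.ne']
    gcongr
    refine le_trans (le_of_eq ?_) (h3.trans h4)
    simp only [hG]
    rfl
  have key' : ∀ᵐ ω ∂p, ∀ m : ℕ, 0 < m → ∀ b < (∫ ω, a m ω ∂p) / m,
      ∀ᶠ n : ℕ in atTop, b < a n ω / n := by
    rw [ae_all_iff]
    intro m
    rcases Nat.eq_zero_or_pos m with rfl | hm
    · simp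
    · filter_upwards [key m hm] with ω h _ using h
  filter_upwards [key'] with ω hω b hb
  obtain ⟨m, hm, hm0⟩ := ((hγ.eventually_const_lt hb).and (eventually_gt_atTop 0)).exists
  exact hω m hm0 b hm

lemma isBoundedUnder_div (haC : ∀ n ω, a n ω ≤ C * n) (ω : ℕ → Bool) :
    IsBoundedUnder (· ≤ ·) atTop fun n : ℕ => a n ω / n := by
  refine isBoundedUnder_of_eventually_le (a := C) ?_
  filter_upwards [eventually_gt_atTop 0] with n hn
  rw [div_le_iff₀ (by exact_mod_cast hn)]
  exact haC n ω

lemma isCoboundedUnder_div (ha0 : ∀ n ω, 0 ≤ a n ω) (ω : ℕ → Bool) :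
    IsCoboundedUnder (· ≤ ·) atTop fun n : ℕ => a n ω / n :=
  IsBoundedUnder.isCoboundedUnder_le
    (isBoundedUnder_of ⟨0, fun n => div_nonneg (ha0 n ω) n.cast_nonneg⟩)

lemma limsup_div_nonneg (ha0 : ∀ n ω, 0 ≤ a n ω) (haC : ∀ n ω, a n ω ≤ C * n)
    (ω : ℕ → Bool) : 0 ≤ limsup (fun n : ℕ => a n ω / n) atTop :=
  le_limsup_of_frequently_le
    (Frequently.of_forall fun n => div_nonneg (ha0 n ω) n.cast_nonneg)
    (isBoundedUnder_div haC ω)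

lemma limsup_div_le (ha0 : ∀ n ω, 0 ≤ a n ω) (haC : ∀ n ω, a n ω ≤ C * n)
    (ω : ℕ → Bool) : limsup (fun n : ℕ => a n ω / n) atTop ≤ C := by
  refine limsup_le_of_le (isCoboundedUnder_div ha0 ω) ?_
  filter_upwards [eventually_gt_atTop 0] with n hn
  rw [div_le_iff₀ (by exact_mod_cast hn)]
  exact haC n ω

lemma limsup_div_shiftSeq_le (hsup : ∀ m n ω, a m ω + a n (shiftSeq m ω) ≤ a (m + n) ω)
    (ha0 : ∀ n ω, 0 ≤ a n ω) (haC : ∀ n ω, a n ω ≤ C * n) (m : ℕ) (ω : ℕ → Bool) :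
    limsup (fun n : ℕ => a n (shiftSeq m ω) / n) atTop ≤
      limsup (fun n : ℕ => a n ω / n) atTop := by
  refine le_of_forall_gt_imp_ge_of_dense fun b hb => ?_
  obtain ⟨c, hc, hcb⟩ := exists_between hb
  refine limsup_le_of_le (isCoboundedUnder_div ha0 _) ?_
  have h1 := eventually_lt_of_limsup_lt hc (isBoundedUnder_div haC ω)
  have h2 : ∀ᶠ n : ℕ in atTop, c * m ≤ (b - c) * n := by
    have : Tendsto (fun n : ℕ => (b - c) * (n : ℝ)) atTop atTop :=
      tendsto_natCast_atTop_atTop.const_mul_atTop (by linarith)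
    exact this.eventually_ge_atTop _
  filter_upwards [(tendsto_add_atTop_nat m).eventually h1, h2, eventually_gt_atTop 0]
    with n hn1 hn2 hn0
  have hn0' : (0 : ℝ) < n := by exact_mod_cast hn0
  rw [div_lt_iff₀ (by exact_mod_cast Nat.add_pos_left hn0 m)] at hn1
  rw [div_le_iff₀ hn0']
  have h3 := hsup m n ω
  have h4 := ha0 m ω
  rw [add_comm m n] at h3
  push_cast at hn1
  linarith

lemma exists_mul_limsup_sub_le (ha0 : ∀ n ω, 0 ≤ a n ω) {ε : ℝ} (hε : 0 < ε) (ω : ℕ → Bool) :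
    ∃ n : ℕ, 1 ≤ n ∧ n * max (limsup (fun n : ℕ => a n ω / n) atTop - ε) 0 ≤ a n ω := by
  have h1 : limsup (fun n : ℕ => a n ω / n) atTop - ε < limsup (fun n : ℕ => a n ω / n) atTop := by
    linarith
  obtain ⟨n, hn, hn1⟩ := ((frequently_lt_of_lt_limsup (isCoboundedUnder_div ha0 ω)
    h1).and_eventually
    (eventually_ge_atTop 1)).exists
  refine ⟨n, hn1, ?_⟩
  have hn0 : (0 : ℝ) < n := by exact_mod_cast hn1
  rw [mul_comm, ← le_div_iff₀ hn0]
  exact max_le hn.le (div_nonneg (ha0 n ω) hn0.le)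

/-- Upper bound in the superadditive ergodic theorem. -/
lemma IsCoinMeasure.integral_limsup_le_of_superadditive (hp : IsCoinMeasure p)
    (hm : ∀ n, Measurable (a n))
    (hsup : ∀ m n ω, a m ω + a n (shiftSeq m ω) ≤ a (m + n) ω)
    (ha0 : ∀ n ω, 0 ≤ a n ω) (haC : ∀ n ω, a n ω ≤ C * n)
    (hγ : Tendsto (fun n : ℕ => (∫ ω, a n ω ∂p) / n) atTop (𝓝 γ)) :
    ∫ ω, limsup (fun n : ℕ => a n ω / n) atTop ∂p ≤ γ := by
  have := hp.isProbabilityMeasure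
  set h : (ℕ → Bool) → ℝ := fun ω => limsup (fun n : ℕ => a n ω / n) atTop with hh
  have hmeas : Measurable h := Measurable.limsup fun n => (hm n).div_const _
  have hint : ∀ {f : (ℕ → Bool) → ℝ} {D : ℝ}, Measurable f → (∀ ω, 0 ≤ f ω) →
      (∀ ω, f ω ≤ D) → Integrable f p := fun hf h0 hD =>
    Integrable.of_bound hf.aestronglyMeasurable _ (ae_of_all _ fun ω => by
      rw [Real.norm_of_nonneg (h0 ω)]; exact hD ω)
  have hC : 0 ≤ C := by simpa using (ha0 1 fun _ => false).trans (haC 1 _)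
  have hhint : Integrable h p := hint hmeas (limsup_div_nonneg ha0 haC) (limsup_div_le ha0 haC)
  refine le_of_forall_pos_le_add fun ε hε => ?_
  set g : (ℕ → Bool) → ℝ := fun ω => max (h ω - ε) 0 with hg
  have hgmeas : Measurable g := (hmeas.sub_const ε).max measurable_const
  have hg0 : ∀ ω, 0 ≤ g ω := fun ω => le_max_right _ _
  have hgC : ∀ ω, g ω ≤ C := fun ω =>
    max_le (by linarith [limsup_div_le ha0 haC ω, hh]) hC
  have hgs : ∀ n ω, g (shiftSeq n ω) ≤ g ω := fun n ω =>
    max_le_max_right _ (sub_le_sub_right (limsup_div_shiftSeq_le hsup ha0 haC n ω) ε)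
  have hgint : Integrable g p := hint hgmeas hg0 hgC
  let B : ℕ → Set (ℕ → Bool) := fun K => {ω | ∀ n, 1 ≤ n → n ≤ K → a n ω < n * g ω}
  have hBmeas : ∀ K, MeasurableSet (B K) := by
    intro K
    have : B K = ⋂ n : ℕ, ⋂ (_ : 1 ≤ n), ⋂ (_ : n ≤ K), {ω | a n ω < n * g ω} := by
      ext; simp [B]
    rw [this]
    exact MeasurableSet.iInter fun n => MeasurableSet.iInter fun _ => MeasurableSet.iInter fun _ =>
      measurableSet_lt (hm n) (hgmeas.const_mul _)
  have hB0 : Tendsto (fun K => p.real (B K)) atTop (𝓝 0) := by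
    have hempty : ⋂ K, B K = ∅ := by
      refine Set.eq_empty_of_forall_notMem fun ω hω => ?_
      obtain ⟨n, hn1, hn⟩ := exists_mul_limsup_sub_le ha0 hε ω
      exact absurd (Set.mem_iInter.1 hω n n hn1 le_rfl) (not_lt.2 hn)
    have h1 : Tendsto (fun K => p (B K)) atTop (𝓝 (p (⋂ K, B K))) :=
      tendsto_measure_iInter_atTop (fun K => (hBmeas K).nullMeasurableSet)
        (fun K L hKL ω hω n hn1 hnK => hω n hn1 (hnK.trans hKL)) ⟨0, measure_ne_top _ _⟩
    rw [hempty, measure_empty] at h1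
    simpa [measureReal_def, Function.comp_def] using
      (ENNReal.tendsto_toReal ENNReal.zero_ne_top).comp h1
  have hcov : ∀ K m : ℕ, ((m : ℝ) - K) * (∫ ω, g ω ∂p) - C * (m * p.real (B K))
      ≤ ∫ ω, a m ω ∂p := by
    intro K m
    have hgm : Integrable (fun ω => ((m : ℝ) - K) * g (shiftSeq m ω)) p :=
      ((hp.measurePreserving_shiftSeq m).integrable_comp_of_integrable hgint).const_mul _
    have hBi : ∀ i, Integrable (fun ω => (B K).indicator (1 : (ℕ → Bool) → ℝ) (shiftSeq i ω)) p :=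
      fun i => (hp.measurePreserving_shiftSeq i).integrable_comp_of_integrable
        ((integrable_const (1 : ℝ)).indicator (hBmeas K))
    have hsum : Integrable (fun ω => C * ∑ i ∈ Finset.range m,
        (B K).indicator (1 : (ℕ → Bool) → ℝ) (shiftSeq i ω)) p :=
      (integrable_finsetSum _ fun i _ => hBi i).const_mul C
    have hmono := integral_mono (hgm.sub hsum) (hint (hm m) (ha0 m) (haC m)) fun ω =>
      covering_estimate hsup ha0 hg0 hgC hgs (B := B K) (K := K) (fun ω hω => by
        simpa [B] using hω) m ω
    refine le_trans (le_of_eq ?_) hmono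
    have hshift : ∀ i, ∀ f : (ℕ → Bool) → ℝ, Measurable f →
        ∫ ω, f (shiftSeq i ω) ∂p = ∫ ω, f ω ∂p := by
      intro i f hf
      conv_rhs => rw [← (hp.measurePreserving_shiftSeq i).map_eq]
      exact (integral_map (measurable_shiftSeq i).aemeasurable hf.aestronglyMeasurable).symm
    simp only [Pi.sub_apply]
    rw [integral_sub hgm hsum, integral_const_mul, integral_const_mul,
      integral_finsetSum _ fun i _ => hBi i, hshift m g hgmeas]
    congr 2
    rw [Finset.sum_congr rfl fun i _ =>
      hshift i _ (measurable_one.indicator (hBmeas K))]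
    simp [integral_indicator_one (hBmeas K)]
  have hK : ∀ K : ℕ, (∫ ω, g ω ∂p) - C * p.real (B K) ≤ γ := by
    intro K
    have h1 : Tendsto (fun m : ℕ => (1 - K * (m : ℝ)⁻¹) * (∫ ω, g ω ∂p) - C * p.real (B K)) atTop
        (𝓝 ((1 - K * 0) * (∫ ω, g ω ∂p) - C * p.real (B K))) :=
      ((((tendsto_inv_atTop_nhds_zero_nat (𝕜 := ℝ)).const_mul (K : ℝ)).const_sub 1).mul_const
        _).sub_const _
    rw [mul_zero, sub_zero, one_mul] at h1
    refine le_of_tendsto_of_tendsto h1 hγ ?_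
    filter_upwards [eventually_gt_atTop 0] with m hm0
    have hm0' : (0 : ℝ) < m := by exact_mod_cast hm0
    rw [le_div_iff₀ hm0']
    refine le_trans (le_of_eq ?_) (hcov K m)
    field_simp
  have hgγ : ∫ ω, g ω ∂p ≤ γ := by
    have h1 := (hB0.const_mul C).const_sub (∫ ω, g ω ∂p)
    rw [mul_zero, sub_zero] at h1
    exact le_of_tendsto' h1 hK
  calc ∫ ω, h ω ∂p ≤ ∫ ω, (g ω + ε) ∂p :=
        integral_mono hhint (hgint.add (integrable_const ε)) fun ω => by
          have := le_max_left (h ω - ε) 0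
          simp only [hg]
          linarith
    _ = (∫ ω, g ω ∂p) + ε := by rw [integral_add hgint (integrable_const ε)]; simp
    _ ≤ γ + ε := by linarith

/-- The superadditive ergodic theorem for nonnegative functionals of finitely many coins. -/
theorem IsCoinMeasure.tendsto_of_superadditive (hp : IsCoinMeasure p)
    (hG : ∀ n, ∃ G : (Fin n → Bool) → ℝ, ∀ ω, a n ω = G fun i => ω i)
    (hsup : ∀ m n ω, a m ω + a n (shiftSeq m ω) ≤ a (m + n) ω)
    (ha0 : ∀ n ω, 0 ≤ a n ω) (haC : ∀ n ω, a n ω ≤ C * n)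
    (hγ : Tendsto (fun n : ℕ => (∫ ω, a n ω ∂p) / n) atTop (𝓝 γ)) :
    ∀ᵐ ω ∂p, Tendsto (fun n : ℕ => a n ω / n) atTop (𝓝 γ) := by
  have := hp.isProbabilityMeasure
  have hm : ∀ n, Measurable (a n) := fun n => by
    obtain ⟨G, hG⟩ := hG n
    rw [funext hG]
    exact measurable_comp_prefix G
  have hlow := hp.ae_eventually_lt_of_superadditive hG hsup ha0 hγ
  set h : (ℕ → Bool) → ℝ := fun ω => limsup (fun n : ℕ => a n ω / n) atTop
  have hle : (fun _ => γ) ≤ᵐ[p] h := by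
    filter_upwards [hlow] with ω hω
    refine le_of_forall_lt_imp_le_of_dense fun b hb => ?_
    exact le_limsup_of_frequently_le ((hω b hb).mono fun _ => le_of_lt).frequently
      (isBoundedUnder_div haC ω)
  have hint : Integrable h p := by
    refine Integrable.of_bound (C := C)
      (Measurable.limsup fun n => (hm n).div_const _).aestronglyMeasurable
      (ae_of_all _ fun ω => ?_)
    rw [Real.norm_of_nonneg (limsup_div_nonneg ha0 haC ω)]
    exact limsup_div_le ha0 haC ω
  have heq : (fun _ => γ) =ᵐ[p] h := by
    refine (integral_eq_iff_of_ae_le (integrable_const γ) hint hle).1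
      (le_antisymm (integral_mono_ae (integrable_const γ) hint hle) ?_)
    simpa using hp.integral_limsup_le_of_superadditive hm hsup ha0 haC hγ
  filter_upwards [hlow, heq] with ω hω hω'
  refine tendsto_order.2 ⟨fun b hb => hω b hb, fun b hb => ?_⟩
  exact eventually_lt_of_limsup_lt (hω'.symm.trans_lt hb) (isBoundedUnder_div haC ω)

end Superadditive

/-! ### Words, their values and Fibonacci sums -/

lemma gold_eq_goldenRatio : gold = Real.goldenRatio := rfl

lemma one_lt_gold : 1 < gold := Real.one_lt_goldenRatio

lemma gold_pos : 0 < gold := Real.goldenRatio_pos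

lemma gold_sq : gold ^ 2 = gold + 1 := Real.goldenRatio_sq

lemma logb_gold_nonneg (n : ℕ) : 0 ≤ Real.logb gold n := by
  rcases Nat.eq_zero_or_pos n with rfl | h
  · simp
  · exact Real.logb_nonneg one_lt_gold (by exact_mod_cast h)

lemma wordVal_append (u v : List Bool) :
    wordVal (u ++ v) = wordVal u + wordVal v / gold ^ u.length := by
  have := gold_pos
  induction u with
  | nil => simp [wordVal]
  | cons b t ih =>
    simp only [List.cons_append, wordVal, ih, List.length_cons]
    field_simp
    ring

instance finite_sameValue (w : List Bool) :
    Finite {v : List Bool // v.length = w.length ∧ wordVal v = wordVal w} :=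
  ((List.finite_length_eq Bool w.length).subset fun _ h => h.1 :
    {v : List Bool | v.length = w.length ∧ wordVal v = wordVal w}.Finite).to_subtype

lemma wordF_pos (w : List Bool) : 0 < wordF w :=
  Nat.card_pos_iff.2 ⟨⟨w, rfl, rfl⟩, inferInstance⟩

lemma wordF_le (w : List Bool) : wordF w ≤ 2 ^ w.length := by
  have h := Nat.card_le_card_of_injective (β := List.Vector Bool w.length)
    (fun v : {v : List Bool // v.length = w.length ∧ wordVal v = wordVal w} =>
      ⟨v.1, v.2.1⟩) fun v v' h => Subtype.ext (congrArg List.Vector.toList h)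
  rwa [Nat.card_eq_fintype_card (α := List.Vector Bool w.length), card_vector,
    Fintype.card_bool] at h

lemma wordF_mul_le (u v : List Bool) : wordF u * wordF v ≤ wordF (u ++ v) := by
  rw [wordF, wordF, ← Nat.card_prod, wordF]
  refine Nat.card_le_card_of_injective
    (fun q => ⟨q.1.1 ++ q.2.1, by simp [q.1.2.1, q.2.2.1], by
      rw [wordVal_append, wordVal_append, q.1.2.1, q.1.2.2, q.2.2.2]⟩) ?_
  rintro ⟨⟨u1, h1⟩, ⟨v1, k1⟩⟩ ⟨⟨u2, h2⟩, ⟨v2, k2⟩⟩ h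
  have := List.append_inj (Subtype.ext_iff.1 h) (h1.1.trans h2.1.symm)
  simp_all

lemma wordF_congr {u v : List Bool} (hl : u.length = v.length) (hv : wordVal u = wordVal v) :
    wordF u = wordF v := by
  rw [wordF, wordF, hl, hv]

/-- The sum `∑ b_j Fib(m_j + i)` over the letters `b_j` of a word, where `m_j` is the number of
letters following `b_j`. -/
def fibWeight (i : ℕ) : List Bool → ℕ
  | [] => 0
  | b :: t => (if b then Nat.fib (t.length + i) else 0) + fibWeight i t

lemma fibWeight_two (w : List Bool) : fibWeight 2 w = fibWeight 0 w + fibWeight 1 w := by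
  induction w with
  | nil => rfl
  | cons b t ih =>
    cases b
    · simp [fibWeight, ih]
    · simp only [fibWeight, if_true, ih, add_zero, Nat.fib_add_two]
      ring

lemma wordVal_mul_pow (w : List Bool) :
    wordVal w * gold ^ w.length = fibWeight 1 w - Real.goldenConj * fibWeight 0 w := by
  have := gold_pos
  induction w with
  | nil => simp [wordVal, fibWeight]
  | cons b t ih =>
    have h : wordVal (b :: t) * gold ^ (b :: t).length
        = (if b then 1 else 0) * gold ^ t.length + wordVal t * gold ^ t.length := by
      simp only [wordVal, List.length_cons, pow_succ]
      field_simp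
    rw [h, ih]
    cases b
    · simp [fibWeight]
    · simp only [fibWeight, if_true, one_mul, add_zero, Nat.cast_add, gold_eq_goldenRatio]
      rw [← Real.fib_succ_sub_goldenConj_mul_fib]
      ring

lemma abs_fibWeight_sub_lt {v w : List Bool} (h : v.length = w.length) :
    |((fibWeight 1 v : ℝ) - Real.goldenRatio * fibWeight 0 v)
      - ((fibWeight 1 w : ℝ) - Real.goldenRatio * fibWeight 0 w)|
      ≤ Real.goldenRatio ^ 2 * (1 - (-Real.goldenConj) ^ w.length) := by
  induction v generalizing w with
  | nil =>
    obtain rfl : w = [] := List.length_eq_zero_iff.1 h.symm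
    simp [fibWeight]
  | cons b t ih =>
    obtain ⟨c, s, rfl⟩ : ∃ c s, w = c :: s := List.exists_cons_of_length_eq_add_one h.symm
    have hts : t.length = s.length := by simpa using h
    have h1 := ih hts
    have h2 : ∀ (c : Bool) (s : List Bool),
        (fibWeight 1 (c :: s) : ℝ) - Real.goldenRatio * fibWeight 0 (c :: s)
          = (if c then Real.goldenConj ^ s.length else 0)
            + ((fibWeight 1 s : ℝ) - Real.goldenRatio * fibWeight 0 s) := by
      intro c s
      cases c
      · simp [fibWeight]
      · simp only [fibWeight, if_true, add_zero, Nat.cast_add]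
        rw [← Real.fib_succ_sub_goldenRatio_mul_fib]
        ring
    rw [h2, h2, hts, List.length_cons]
    have h3 : |(if b then Real.goldenConj ^ s.length else 0)
        - (if c then Real.goldenConj ^ s.length else (0 : ℝ))|
        ≤ (-Real.goldenConj) ^ s.length := by
      have h4 : |Real.goldenConj ^ s.length| = (-Real.goldenConj) ^ s.length := by
        rw [abs_pow, abs_of_neg Real.goldenConj_neg]
      have h5 : 0 ≤ (-Real.goldenConj) ^ s.length := h4 ▸ abs_nonneg _
      cases b <;> cases c <;> simp [h4, h5]
    have h4 : Real.goldenRatio ^ 2 * (-Real.goldenConj) ^ (s.length + 1)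
        = Real.goldenRatio ^ 2 * (-Real.goldenConj) ^ s.length
          - (-Real.goldenConj) ^ s.length := by
      have h5 : Real.goldenRatio ^ 2 * (-Real.goldenConj) = Real.goldenRatio := by
        linear_combination (-Real.goldenRatio) * Real.goldenRatio_mul_goldenConj
      linear_combination (-Real.goldenConj) ^ s.length * h5
        - (-Real.goldenConj) ^ s.length * Real.goldenRatio_sq
    rw [abs_le] at h1 h3 ⊢
    constructor <;> linarith [h1.1, h1.2, h3.1, h3.2]

/-- Words of the same length have the same value in base `λ` iff they have the same value in the
Fibonacci numeration. -/
lemma wordVal_eq_iff {v w : List Bool} (h : v.length = w.length) :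
    wordVal v = wordVal w ↔ fibWeight 2 v = fibWeight 2 w := by
  have hpow : gold ^ w.length ≠ 0 := pow_ne_zero _ gold_pos.ne'
  have hv := wordVal_mul_pow v
  have hw := wordVal_mul_pow w
  rw [h] at hv
  rw [fibWeight_two, fibWeight_two]
  constructor
  · intro heq
    rw [heq, hw] at hv
    have h0 : ((fibWeight 1 v : ℤ) - fibWeight 1 w : ℤ)
        = Real.goldenConj * ((fibWeight 0 v : ℤ) - fibWeight 0 w : ℤ) := by
      push_cast
      linarith
    by_cases hz : ((fibWeight 0 v : ℤ) - fibWeight 0 w : ℤ) = 0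
    · rw [hz, Int.cast_zero, mul_zero] at h0
      have h1 : ((fibWeight 1 v : ℤ) - fibWeight 1 w : ℤ) = 0 := by exact_mod_cast h0
      lia
    · exact absurd ⟨_, h0⟩ (Real.goldenConj_irrational.mul_intCast hz)
  · intro heq
    have hlt : |((fibWeight 1 v : ℝ) - Real.goldenRatio * fibWeight 0 v)
        - ((fibWeight 1 w : ℝ) - Real.goldenRatio * fibWeight 0 w)| < Real.goldenRatio ^ 2 := by
      refine (abs_fibWeight_sub_lt h).trans_lt ?_
      have h1 : 0 < (-Real.goldenConj) ^ w.length :=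
        pow_pos (neg_pos.2 Real.goldenConj_neg) _
      nlinarith [pow_pos Real.goldenRatio_pos 2]
    have heq' : (fibWeight 0 v : ℝ) + fibWeight 1 v = fibWeight 0 w + fibWeight 1 w := by
      exact_mod_cast heq
    have h1 : ((fibWeight 1 v : ℝ) - Real.goldenRatio * fibWeight 0 v)
        - ((fibWeight 1 w : ℝ) - Real.goldenRatio * fibWeight 0 w)
        = -(((fibWeight 0 v : ℤ) - fibWeight 0 w : ℤ) : ℝ) * Real.goldenRatio ^ 2 := by
      rw [Real.goldenRatio_sq]
      push_cast
      linarith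
    rw [h1, abs_mul, abs_neg, abs_of_pos (pow_pos Real.goldenRatio_pos 2),
      mul_lt_iff_lt_one_left (pow_pos Real.goldenRatio_pos 2), ← Int.cast_abs] at hlt
    have h2 : ((fibWeight 0 v : ℤ) - fibWeight 0 w : ℤ) = 0 :=
      Int.abs_lt_one_iff.1 (by exact_mod_cast hlt)
    have h3 : fibWeight 0 v = fibWeight 0 w := by lia
    have h4 : fibWeight 1 v = fibWeight 1 w := by lia
    rw [h3, h4, ← hw] at hv
    exact mul_right_cancel₀ hpow hv

lemma sum_fibF_eq_fibWeight {n : ℕ} (ε : Fin n → Bool) :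
    (∑ j : Fin n, if ε j then fibF (j + 1) else 0)
      = fibWeight 2 (List.ofFn fun i => ε i.rev) := by
  induction n with
  | zero => simp [fibWeight]
  | succ n ih =>
    have h := ih fun i => ε i.castSucc
    rw [Fin.sum_univ_castSucc, List.ofFn_succ, fibWeight]
    simp only [Fin.val_castSucc, Fin.val_last, Fin.rev_zero, Fin.rev_succ, List.length_ofFn] at h ⊢
    rw [h, add_comm]
    rfl

lemma countRep_fibWeight {n : ℕ} {w : List Bool} (hw : w.length = n) :
    countRep n (fibWeight 2 w) = wordF w := by
  rw [countRep, wordF, ← Fintype.card_subtype, ← Nat.card_eq_fintype_card]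
  refine Nat.card_eq_of_bijective (fun ε => ⟨List.ofFn fun i => ε.1 i.rev, ?_, ?_⟩) ⟨?_, ?_⟩
  · simp [hw]
  · rw [wordVal_eq_iff (by simp [hw]), ← sum_fibF_eq_fibWeight]
    exact ε.2
  · intro ε ε' h
    have h1 := List.ofFn_injective (Subtype.ext_iff.1 h)
    ext i
    simpa using congrFun h1 i.rev
  · rintro ⟨v, hv1, hv2⟩
    obtain rfl : v.length = n := hv1.trans hw
    have h1 : (List.ofFn fun i : Fin v.length => v[i.rev.rev]) = v := by simp
    refine ⟨⟨fun i => v[i.rev], ?_⟩, Subtype.ext h1⟩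
    rw [sum_fibF_eq_fibWeight, h1, (wordVal_eq_iff hv1).1 hv2]

lemma sum_fibF_lt {n : ℕ} (ε : Fin n → Bool) :
    (∑ j : Fin n, if ε j then fibF (j + 1) else 0) < fibF (n + 2) - 1 := by
  have h1 : (∑ j : Fin n, if ε j then fibF (j + 1) else 0) ≤ ∑ j : Fin n, fibF (j + 1) :=
    Finset.sum_le_sum fun j _ => by split_ifs <;> simp
  have h2 : ∀ n, (∑ j : Fin n, fibF (j + 1)) + 2 = fibF (n + 2) := by
    intro n
    induction n with
    | zero => rfl
    | succ n ih =>
      rw [Fin.sum_univ_castSucc]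
      simp only [Fin.val_castSucc, Fin.val_last]
      have h3 : fibF (n + 1 + 2) = fibF (n + 1) + fibF (n + 2) := Nat.fib_add_two
      lia
  have := h2 n
  lia

/-! ### The exponent of a 0-1 sequence and the entropies -/

/-- The prefix of length `n` of a 0-1 sequence. -/
def prefixWord (n : ℕ) (ω : ℕ → Bool) : List Bool := (List.range n).map ω

@[simp] lemma length_prefixWord (n : ℕ) (ω : ℕ → Bool) : (prefixWord n ω).length = n := by
  simp [prefixWord]

lemma prefixWord_add (m n : ℕ) (ω : ℕ → Bool) :
    prefixWord (m + n) ω = prefixWord m ω ++ prefixWord n (shiftSeq m ω) := by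
  simp [prefixWord, List.range_add, shiftSeq, Function.comp_def]

lemma prefixWord_eq_ofFn (n : ℕ) (ω : ℕ → Bool) :
    prefixWord n ω = List.ofFn fun i : Fin n => ω i := by
  refine List.ext_getElem (by simp) fun i h1 h2 => ?_
  simp [prefixWord]

/-- The logarithm of the number of words equivalent to the prefix of length `n`. -/
noncomputable def logCount (n : ℕ) (ω : ℕ → Bool) : ℝ := Real.logb gold (wordF (prefixWord n ω))

/-- `logCount` as a function of a prefix. -/
noncomputable def wordLog (n : ℕ) (v : Fin n → Bool) : ℝ := Real.logb gold (wordF (List.ofFn v))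

lemma logCount_eq (n : ℕ) (ω : ℕ → Bool) : logCount n ω = wordLog n fun i => ω i := by
  rw [logCount, wordLog, prefixWord_eq_ofFn]

lemma measurable_logCount (n : ℕ) : Measurable (logCount n) := by
  rw [funext (logCount_eq n)]
  exact measurable_comp_prefix (wordLog n)

lemma logCount_nonneg (n : ℕ) (ω : ℕ → Bool) : 0 ≤ logCount n ω := logb_gold_nonneg _

lemma logCount_le (n : ℕ) (ω : ℕ → Bool) : logCount n ω ≤ Real.logb gold 2 * n := by
  have h : (wordF (prefixWord n ω) : ℝ) ≤ 2 ^ n := by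
    have := wordF_le (prefixWord n ω)
    rw [length_prefixWord] at this
    exact_mod_cast this
  calc logCount n ω ≤ Real.logb gold (2 ^ n) :=
        Real.logb_le_logb_of_le one_lt_gold (by exact_mod_cast wordF_pos _) h
    _ = Real.logb gold 2 * n := by rw [Real.logb_pow, mul_comm]

lemma logCount_superadditive (m n : ℕ) (ω : ℕ → Bool) :
    logCount m ω + logCount n (shiftSeq m ω) ≤ logCount (m + n) ω := by
  have h1 : (wordF (prefixWord m ω) : ℝ) ≠ 0 := by exact_mod_cast (wordF_pos _).ne'
  have h2 : (wordF (prefixWord n (shiftSeq m ω)) : ℝ) ≠ 0 := by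
    exact_mod_cast (wordF_pos _).ne'
  rw [logCount, logCount, logCount, ← Real.logb_mul h1 h2, prefixWord_add]
  refine Real.logb_le_logb_of_le one_lt_gold (by positivity) ?_
  exact_mod_cast wordF_mul_le _ _

section Entropy

variable {p : Measure (ℕ → Bool)}

lemma IsCoinMeasure.integral_logCount (hp : IsCoinMeasure p) (n : ℕ) :
    ∫ ω, logCount n ω ∂p = Real.logb gold 2 * n - Hent n := by
  set S : (Fin n → Bool) → ℕ := fun ε => ∑ j : Fin n, if ε j then fibF (j + 1) else 0 with hS
  have hmaps : ∀ ε ∈ (Finset.univ : Finset (Fin n → Bool)),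
      S ε ∈ Finset.range (fibF (n + 2) - 1) := fun ε _ => Finset.mem_range.2 (sum_fibF_lt ε)
  have hcard : ∑ k ∈ Finset.range (fibF (n + 2) - 1), (countRep n k : ℝ) = 2 ^ n := by
    have h := Finset.card_eq_sum_card_fiberwise hmaps
    rw [Finset.card_univ, Fintype.card_fun, Fintype.card_bool, Fintype.card_fin] at h
    exact_mod_cast h.symm
  have hint : ∫ ω, logCount n ω ∂p = ∑ k ∈ Finset.range (fibF (n + 2) - 1),
      (countRep n k : ℝ) / 2 ^ n * Real.logb gold (countRep n k) := by
    simp_rw [logCount_eq]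
    rw [hp.integral_comp_prefix, ← (Equiv.arrowCongr Fin.revPerm (Equiv.refl Bool)).sum_comp,
      ← Finset.sum_fiberwise_of_maps_to hmaps]
    refine Finset.sum_congr rfl fun k _ => ?_
    have : ∀ ε ∈ Finset.univ.filter fun ε => S ε = k,
        wordLog n (Equiv.arrowCongr Fin.revPerm (Equiv.refl Bool) ε) / 2 ^ n
          = Real.logb gold (countRep n k) / 2 ^ n := by
      intro ε hε
      rw [← (Finset.mem_filter.1 hε).2, hS]
      simp only
      rw [sum_fibF_eq_fibWeight, countRep_fibWeight (by simp)]
      rfl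
    rw [Finset.sum_congr rfl this, Finset.sum_const, nsmul_eq_mul, countRep]
    ring
  have hterm : ∀ k, (countRep n k : ℝ) / 2 ^ n * Real.logb gold ((countRep n k : ℝ) / 2 ^ n)
      = (countRep n k : ℝ) / 2 ^ n * Real.logb gold (countRep n k)
        - countRep n k * (n * Real.logb gold 2 / 2 ^ n) := by
    intro k
    rcases eq_or_ne (countRep n k) 0 with h | h
    · simp [h]
    · rw [Real.logb_div (by exact_mod_cast h) (by positivity), Real.logb_pow]
      ring
  rw [Hent, Finset.sum_congr rfl fun k _ => hterm k, Finset.sum_sub_distrib, ← Finset.sum_mul,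
    hcard, ← hint]
  field_simp
  ring

lemma IsCoinMeasure.exists_tendsto_Hent (hp : IsCoinMeasure p) :
    ∃ H, Tendsto (fun n : ℕ => Hent n / n) atTop (𝓝 H) := by
  have := hp.isProbabilityMeasure
  have hint : ∀ n, Integrable (logCount n) p := fun n => by
    rw [funext (logCount_eq n)]
    exact integrable_comp_prefix (wordLog n)
  have hsub : Subadditive Hent := by
    intro m n
    have h1 : ∫ ω, logCount m ω ∂p + ∫ ω, logCount n ω ∂p ≤ ∫ ω, logCount (m + n) ω ∂p := by
      have h2 : ∫ ω, logCount n ω ∂p = ∫ ω, logCount n (shiftSeq m ω) ∂p := by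
        conv_lhs => rw [← (hp.measurePreserving_shiftSeq m).map_eq]
        exact integral_map (measurable_shiftSeq m).aemeasurable
          (measurable_logCount n).aestronglyMeasurable
      have h3 : Integrable (fun ω => logCount n (shiftSeq m ω)) p :=
        (hp.measurePreserving_shiftSeq m).integrable_comp_of_integrable (hint n)
      rw [h2, ← integral_add (hint m) h3]
      exact integral_mono ((hint m).add h3) (hint (m + n)) fun ω => logCount_superadditive m n ω
    rw [hp.integral_logCount, hp.integral_logCount, hp.integral_logCount] at h1
    push_cast at h1
    linarith
  refine ⟨hsub.lim, hsub.tendsto_lim ⟨0, ?_⟩⟩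
  rintro _ ⟨n, rfl⟩
  have h1 : ∫ ω, logCount n ω ∂p ≤ Real.logb gold 2 * n := by
    have h2 := integral_mono (hint n) (integrable_const (Real.logb gold 2 * n))
      fun ω => logCount_le n ω
    simpa using h2
  rw [hp.integral_logCount] at h1
  exact div_nonneg (by linarith) n.cast_nonneg

lemma IsCoinMeasure.tendsto_logCount (hp : IsCoinMeasure p) {H : ℝ}
    (hH : Tendsto (fun n : ℕ => Hent n / n) atTop (𝓝 H)) :
    ∀ᵐ ω ∂p, Tendsto (fun n : ℕ => logCount n ω / n) atTop (𝓝 (Real.logb gold 2 - H)) := by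
  refine hp.tendsto_of_superadditive (fun n => ⟨wordLog n, logCount_eq n⟩) logCount_superadditive
    logCount_nonneg logCount_le ((hH.const_sub (Real.logb gold 2)).congr' ?_)
  filter_upwards [eventually_gt_atTop 0] with n hn
  have hn' : (n : ℝ) ≠ 0 := by exact_mod_cast hn.ne'
  rw [hp.integral_logCount, sub_div, mul_div_cancel_right₀ _ hn']

end Entropy

/-! ### Synchronization with the greedy expansion -/

/-- The value `∑ ω_k λ^{-(k+1)}` of an infinite 0-1 sequence. -/
noncomputable def seqVal (ω : ℕ → Bool) : ℝ := ∑' k : ℕ, if ω k then gold⁻¹ ^ (k + 1) else 0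

lemma hasSum_inv_gold_pow : HasSum (fun k : ℕ => gold⁻¹ ^ (k + 1)) gold := by
  have h := (hasSum_geometric_of_lt_one (inv_nonneg.2 gold_pos.le)
    (inv_lt_one_of_one_lt₀ one_lt_gold)).mul_right gold⁻¹
  simp_rw [← pow_succ] at h
  have h2 := gold_pos.ne'
  have h4 : (1 - gold⁻¹)⁻¹ * gold⁻¹ = gold := by
    rw [← mul_inv, sub_mul, inv_mul_cancel₀ h2, one_mul, inv_eq_iff_eq_inv]
    refine eq_inv_of_mul_eq_one_left ?_
    linear_combination gold_sq
  rwa [h4] at h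

lemma summable_seqVal (ω : ℕ → Bool) :
    Summable fun k : ℕ => if ω k then gold⁻¹ ^ (k + 1) else (0 : ℝ) := by
  have h0 := inv_nonneg.2 gold_pos.le
  refine Summable.of_nonneg_of_le (fun k => ?_) (fun k => ?_) hasSum_inv_gold_pow.summable <;>
  split_ifs <;> first | positivity | exact le_rfl

lemma seqVal_nonneg (ω : ℕ → Bool) : 0 ≤ seqVal ω := by
  have h0 := inv_nonneg.2 gold_pos.le
  exact tsum_nonneg fun k => by split_ifs <;> positivity

lemma seqVal_le (ω : ℕ → Bool) : seqVal ω ≤ gold := by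
  have h0 := inv_nonneg.2 gold_pos.le
  rw [← hasSum_inv_gold_pow.tsum_eq]
  refine (summable_seqVal ω).tsum_le_tsum (fun k => ?_) hasSum_inv_gold_pow.summable
  split_ifs <;> first | positivity | exact le_rfl

lemma seqVal_eq (ω : ℕ → Bool) :
    gold * seqVal ω = (if ω 0 then 1 else 0) + seqVal (shiftSeq 1 ω) := by
  have h2 := gold_pos.ne'
  rw [seqVal, (summable_seqVal ω).tsum_eq_zero_add, mul_add, seqVal, ← tsum_mul_left]
  congr 1
  · split_ifs <;> simp [h2]
  · refine tsum_congr fun k => ?_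
    simp only [shiftSeq, add_comm 1 k]
    split_ifs
    · rw [pow_succ' _ (k + 1), mul_inv_cancel_left₀ h2]
    · simp

lemma gold_mul_seqVal_shiftSeq (n : ℕ) (ω : ℕ → Bool) :
    gold * seqVal (shiftSeq n ω) = (if ω n then 1 else 0) + seqVal (shiftSeq (n + 1) ω) := by
  rw [seqVal_eq, shiftSeq_shiftSeq]
  rfl

lemma wordVal_prefixWord_succ (n : ℕ) (ω : ℕ → Bool) :
    wordVal (prefixWord (n + 1) ω)
      = wordVal (prefixWord n ω) + (if ω n then 1 else 0) / gold ^ (n + 1) := by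
  rw [prefixWord_add, wordVal_append, length_prefixWord, pow_succ', ← div_div]
  simp [prefixWord, wordVal, shiftSeq]

/-- If the remainders `t n` satisfy `t (n + 1) = λ t n - ω n`, the prefixes of `ω` expand `t 0`. -/
lemma wordVal_prefixWord_of_remainder {ω : ℕ → Bool} {t : ℕ → ℝ}
    (ht : ∀ n, gold * t n = (if ω n then 1 else 0) + t (n + 1)) (n : ℕ) :
    wordVal (prefixWord n ω) = t 0 - t n / gold ^ n := by
  have := gold_pos
  induction n with
  | zero => simp [prefixWord, wordVal]
  | succ n ih =>
    rw [wordVal_prefixWord_succ, ih, eq_sub_of_add_eq' (ht n).symm]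
    field_simp
    ring

/-- The greedy digits of `x` as a 0-1 sequence. -/
noncomputable def greedySeq (x : ℝ) (j : ℕ) : Bool := decide (digit j x = 1)

lemma iterate_Tgold_mem {x : ℝ} (hx : x ∈ Set.Ico (0 : ℝ) 1) (n : ℕ) :
    Tgold^[n] x ∈ Set.Ico (0 : ℝ) 1 := by
  cases n with
  | zero => exact hx
  | succ n =>
    rw [Function.iterate_succ_apply']
    exact ⟨Int.fract_nonneg _, Int.fract_lt_one _⟩

lemma gold_mul_iterate_Tgold {x : ℝ} (hx : x ∈ Set.Ico (0 : ℝ) 1) (n : ℕ) :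
    gold * Tgold^[n] x = (if greedySeq x n then 1 else 0) + Tgold^[n + 1] x := by
  have h1 := iterate_Tgold_mem hx n
  have h2 := gold_pos
  have h3 : gold < 2 := Real.goldenRatio_lt_two
  have h4 : (0 : ℤ) ≤ digit n x := Int.floor_nonneg.2 (mul_nonneg h2.le h1.1)
  have h5 : digit n x < 2 := Int.floor_lt.2 (by push_cast; nlinarith [h1.1, h1.2])
  have h6 : ((if greedySeq x n then 1 else 0 : ℝ)) = digit n x := by
    obtain h | h : digit n x = 0 ∨ digit n x = 1 := by lia
    all_goals simp [greedySeq, h]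
  rw [Function.iterate_succ_apply', Tgold, h6]
  exact (Int.floor_add_fract _).symm

/-- The greedy remainder minus the remainder of any other expansion takes only four values. -/
lemma remainder_sub_mem {x : ℝ} (hx : x ∈ Set.Ico (0 : ℝ) 1) {ω : ℕ → Bool} (hω : seqVal ω = x)
    (n : ℕ) : Tgold^[n] x - seqVal (shiftSeq n ω) ∈ ({0, -1, 1 - gold, -gold} : Set ℝ) := by
  induction n with
  | zero => simp [shiftSeq_zero, hω]
  | succ n ih =>
    have h1 := gold_mul_iterate_Tgold hx n
    have h2 := gold_mul_seqVal_shiftSeq n ω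
    have h3 := (iterate_Tgold_mem hx (n + 1)).1
    have h4 := (iterate_Tgold_mem hx (n + 1)).2
    have h5 := seqVal_nonneg (shiftSeq (n + 1) ω)
    have h6 := seqVal_le (shiftSeq (n + 1) ω)
    have h7 := gold_sq
    have h8 := one_lt_gold
    simp only [Set.mem_insert_iff, Set.mem_singleton_iff] at ih ⊢
    generalize Tgold^[n] x = t at *
    generalize Tgold^[n + 1] x = t' at *
    generalize seqVal (shiftSeq n ω) = y at *
    generalize seqVal (shiftSeq (n + 1) ω) = y' at *
    have hd : (if greedySeq x n then 1 else 0 : ℝ) = 0 ∨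
        (if greedySeq x n then 1 else 0 : ℝ) = 1 := by
      split_ifs <;> simp
    have he : (if ω n then 1 else 0 : ℝ) = 0 ∨ (if ω n then 1 else 0 : ℝ) = 1 := by
      split_ifs <;> simp
    generalize (if greedySeq x n then 1 else 0 : ℝ) = d at *
    generalize (if ω n then 1 else 0 : ℝ) = e at *
    have hrec : t' - y' = gold * (t - y) + e - d := by linarith
    rcases ih with h | h | h | h <;> rcases hd with rfl | rfl <;> rcases he with rfl | rfl <;>
      rw [h] at hrec <;>
      first
      | (exfalso; nlinarith)
      | (left; linarith)
      | (right; left; nlinarith)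
      | (right; right; left; nlinarith)
      | (right; right; right; nlinarith)

/-- After `000` has been read from position `n` on, any expansion of `x` and the greedy one have
equivalent prefixes of length `n`. -/
lemma logCount_greedySeq_eq {x : ℝ} (hx : x ∈ Set.Ico (0 : ℝ) 1) {ω : ℕ → Bool}
    (hω : seqVal ω = x) {n : ℕ} (h0 : ω n = false) (h1 : ω (n + 1) = false)
    (h2 : ω (n + 2) = false) : logCount n (greedySeq x) = logCount n ω := by
  have hy0 := gold_mul_seqVal_shiftSeq n ω
  have hy1 := gold_mul_seqVal_shiftSeq (n + 1) ω
  have hy2 := gold_mul_seqVal_shiftSeq (n + 2) ω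
  have hle := seqVal_le (shiftSeq (n + 2 + 1) ω)
  have ht := (iterate_Tgold_mem hx n).1
  have hg := gold_sq
  have hg1 := one_lt_gold
  rw [h0, if_neg Bool.false_ne_true, zero_add] at hy0
  rw [h1, if_neg Bool.false_ne_true, zero_add] at hy1
  rw [h2, if_neg Bool.false_ne_true, zero_add] at hy2
  have hsmall : seqVal (shiftSeq n ω) ≤ 2 - gold := by
    have h3 : gold ^ 2 * seqVal (shiftSeq n ω) ≤ 1 := by
      rw [← hy2, ← hy1, ← hy0] at hle
      nlinarith
    have h4 : gold ^ 2 * (2 - gold) = 1 := by linear_combination (1 - gold) * hg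
    nlinarith
  have heq : Tgold^[n] x = seqVal (shiftSeq n ω) := by
    rcases remainder_sub_mem hx hω n with h | h | h | h
    · linarith
    · linarith
    · nlinarith
    · rw [Set.mem_singleton_iff] at h
      linarith
  have hval : wordVal (prefixWord n (greedySeq x)) = wordVal (prefixWord n ω) := by
    rw [wordVal_prefixWord_of_remainder (gold_mul_iterate_Tgold hx) n,
      wordVal_prefixWord_of_remainder (fun n => gold_mul_seqVal_shiftSeq n ω) n, heq,
      shiftSeq_zero, hω]
    rfl
  rw [logCount, logCount, wordF_congr (by simp) hval]

/-! ### Gaps between synchronization times -/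

/-- Two monotone sequences agreeing at the times `3 i + 1`, `i ∈ P`, have the same growth rate if
`P` has positive density. -/
lemma tendsto_div_of_eq_on {A a : ℕ → ℝ} {P : ℕ → Prop} [DecidablePred P] {c γ : ℝ} (hc : 0 < c)
    (hA : Monotone A) (hP : ∀ i, P i → A (3 * i + 1) = a (3 * i + 1))
    (hr : Tendsto (fun n : ℕ => (Nat.count P n : ℝ) / n) atTop (𝓝 c))
    (ha : Tendsto (fun n : ℕ => a n / n) atTop (𝓝 γ)) :
    Tendsto (fun n : ℕ => A n / n) atTop (𝓝 γ) := by
  have hcount : Tendsto (Nat.count P) atTop atTop := by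
    have h1 : Tendsto (fun n : ℕ => (Nat.count P n : ℝ) / n * n) atTop atTop :=
      hr.pos_mul_atTop hc tendsto_natCast_atTop_atTop
    have h2 : Tendsto (fun n : ℕ => (Nat.count P n : ℝ)) atTop atTop := by
      refine h1.congr' ?_
      filter_upwards [eventually_gt_atTop 0] with n hn
      have : (n : ℝ) ≠ 0 := by exact_mod_cast hn.ne'
      field_simp
    exact tendsto_natCast_atTop_iff.1 h2
  have hinf : {i | P i}.Infinite := by
    intro hfin
    obtain ⟨n, hn⟩ := (hcount.eventually_gt_atTop hfin.toFinset.card).exists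
    refine absurd hn (not_lt.2 ?_)
    rw [Nat.count_eq_card_filter_range]
    exact Finset.card_le_card fun i hi => hfin.mem_toFinset.2 (Finset.mem_filter.1 hi).2
  have he : Tendsto (Nat.nth P) atTop atTop := (Nat.nth_strictMono hinf).tendsto_atTop
  have heq : Tendsto (fun k : ℕ => (Nat.nth P k : ℝ) / k) atTop (𝓝 c⁻¹) := by
    refine ((hr.comp he).inv₀ hc.ne').congr fun k => ?_
    rw [Function.comp_apply, Nat.count_nth_of_infinite hinf, inv_div]
  have hB : Tendsto (fun k : ℕ => A (3 * Nat.nth P k + 1) / k) atTop (𝓝 (γ * (3 * c⁻¹))) := by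
    have hm : Tendsto (fun k => 3 * Nat.nth P k + 1) atTop atTop :=
      tendsto_atTop_mono (fun k => by lia) he
    have h1 : Tendsto (fun k : ℕ => ((3 * Nat.nth P k + 1 : ℕ) : ℝ) / k) atTop
        (𝓝 (3 * c⁻¹)) := by
      have := (heq.const_mul 3).add (tendsto_one_div_atTop_nhds_zero_nat (𝕜 := ℝ))
      rw [add_zero] at this
      refine this.congr fun k => ?_
      push_cast
      ring
    refine ((ha.comp hm).mul h1).congr fun k => ?_
    have h2 : ((3 * Nat.nth P k + 1 : ℕ) : ℝ) ≠ 0 := by positivity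
    rw [Function.comp_apply, hP _ (Nat.nth_mem_of_infinite hinf k), div_mul_div_cancel₀ h2]
  set q : ℕ → ℕ := fun n => Nat.count P (n / 3) with hq
  have hdiv : Tendsto (fun n : ℕ => n / 3) atTop atTop :=
    Nat.tendsto_div_const_atTop (by norm_num)
  have hq' : Tendsto q atTop atTop := hcount.comp hdiv
  have hqn : Tendsto (fun n : ℕ => (q n : ℝ) / n) atTop (𝓝 (c * 3⁻¹)) := by
    refine ((hr.comp hdiv).mul (tendsto_nat_div_div (m := 3) (by norm_num))).congr' ?_
    filter_upwards [eventually_ge_atTop 3] with n hn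
    have h2 : ((n / 3 : ℕ) : ℝ) ≠ 0 := by
      have : 0 < n / 3 := Nat.div_pos hn (by norm_num)
      positivity
    rw [Function.comp_apply, div_mul_div_cancel₀ h2]
  have hγ : γ * (3 * c⁻¹) * (c * 3⁻¹) = γ := by field_simp
  have hlim : ∀ u : ℕ → ℕ, Tendsto u atTop atTop →
      Tendsto (fun n : ℕ => (u n : ℝ) / n) atTop (𝓝 (c * 3⁻¹)) →
      Tendsto (fun n : ℕ => A (3 * Nat.nth P (u n) + 1) / n) atTop (𝓝 γ) := by
    intro u hu hun
    have h := (hB.comp hu).mul hun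
    rw [hγ] at h
    refine h.congr' ?_
    filter_upwards [hu.eventually_gt_atTop 0] with n hn
    have h2 : (u n : ℝ) ≠ 0 := by exact_mod_cast hn.ne'
    rw [Function.comp_apply, div_mul_div_cancel₀ h2]
  have h0 := tendsto_one_div_atTop_nhds_zero_nat (𝕜 := ℝ)
  have hlow := hlim (fun n => q n - 1) ((tendsto_sub_atTop_nat 1).comp hq') (by
    have := hqn.sub h0
    rw [sub_zero] at this
    refine this.congr' ?_
    filter_upwards [hq'.eventually_ge_atTop 1] with n hn
    rw [Nat.cast_sub hn, sub_div, Nat.cast_one])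
  have hup := hlim (fun n => q n + 1) ((tendsto_add_atTop_nat 1).comp hq') (by
    have := hqn.add h0
    rw [add_zero] at this
    refine this.congr fun n => ?_
    push_cast
    ring)
  refine tendsto_of_tendsto_of_tendsto_of_le_of_le' hlow hup ?_ (Eventually.of_forall fun n => ?_)
  · filter_upwards [hq'.eventually_ge_atTop 1] with n hn
    refine div_le_div_of_nonneg_right (hA ?_) n.cast_nonneg
    have : Nat.nth P (q n - 1) < n / 3 := Nat.nth_lt_of_lt_count (by simp only [hq] at hn ⊢; lia)
    lia
  · refine div_le_div_of_nonneg_right (hA ?_) n.cast_nonneg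
    have h1 : n / 3 ≤ Nat.nth P (q n) := Nat.le_nth_count hinf _
    have h2 : Nat.nth P (q n) < Nat.nth P (q n + 1) := Nat.nth_strictMono hinf (Nat.lt_succ_self _)
    lia

/-! ### Almost every point -/

/-- The sequence `0ω`. -/
def consFalse (ω : ℕ → Bool) (k : ℕ) : Bool := if k = 0 then false else ω (k - 1)

lemma shiftSeq_one_consFalse (ω : ℕ → Bool) : shiftSeq 1 (consFalse ω) = ω := by
  funext k; simp [shiftSeq, consFalse]

lemma consFalse_succ (ω : ℕ → Bool) (k : ℕ) : consFalse ω (k + 1) = ω k := by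
  simp [consFalse]

lemma seqVal_consFalse (ω : ℕ → Bool) : seqVal (consFalse ω) = piMap ω := by
  have h2 := gold_pos.ne'
  have h := seqVal_eq (consFalse ω)
  rw [shiftSeq_one_consFalse, mul_comm] at h
  rw [eq_div_of_mul_eq h2 h, piMap, seqVal, consFalse, if_pos rfl, if_neg Bool.false_ne_true,
    zero_add, div_eq_inv_mul, ← tsum_mul_left]
  refine tsum_congr fun k => ?_
  split_ifs
  · rw [← pow_succ']
  · simp

lemma measurable_consFalse : Measurable consFalse := by
  refine measurable_pi_lambda _ fun k => ?_
  cases k with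
  | zero => exact measurable_const
  | succ k => simpa only [consFalse_succ] using measurable_pi_apply k

lemma measurable_piMap : Measurable piMap := by
  refine Measurable.tsum fun k => ?_
  exact (measurable_of_countable fun b : Bool => if b then gold⁻¹ ^ (k + 2) else (0 : ℝ)).comp
    (measurable_pi_apply k)

lemma measurable_digit (k : ℕ) : Measurable (digit k) := by
  have hT : Measurable Tgold := (measurable_const.mul measurable_id).fract
  exact Int.measurable_floor.comp (measurable_const.mul (hT.iterate k))

lemma measurable_greedySeq : Measurable greedySeq := by
  refine measurable_pi_lambda _ fun j => ?_
  exact (measurable_of_countable fun i : ℤ => decide (i = 1)).comp (measurable_digit j)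

lemma measurableSet_tendsto_logCount (γ : ℝ) :
    MeasurableSet {ω | Tendsto (fun n : ℕ => logCount n ω / n) atTop (𝓝 γ)} :=
  measurableSet_tendsto _ fun n => (measurable_logCount n).div_const _

section AlmostEvery

variable {p : Measure (ℕ → Bool)}

lemma IsCoinMeasure.tendsto_logCount_consFalse (hp : IsCoinMeasure p) {H : ℝ}
    (hH : Tendsto (fun n : ℕ => Hent n / n) atTop (𝓝 H)) :
    ∀ᵐ ω ∂p, Tendsto (fun n : ℕ => logCount n (consFalse ω) / n) atTop
      (𝓝 (Real.logb gold 2 - H)) := by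
  have h1 := hp.tendsto_logCount hH
  have h2 := hp.measurePreserving_flip.quasiMeasurePreserving.ae h1
  have hm : MeasurableSet {ω | Tendsto (fun n : ℕ => logCount n (consFalse ω) / n) atTop
      (𝓝 (Real.logb gold 2 - H))} :=
    measurable_consFalse (measurableSet_tendsto_logCount _)
  have h3 : ∀ᵐ ω ∂p, Tendsto (fun n : ℕ => logCount n (consFalse (shiftSeq 1 ω)) / n) atTop
      (𝓝 (Real.logb gold 2 - H)) := by
    filter_upwards [h1, h2] with ω hω hω'
    have hcons : ∀ ω' : ℕ → Bool, ω' 0 = false → shiftSeq 1 ω' = shiftSeq 1 ω →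
        consFalse (shiftSeq 1 ω) = ω' := by
      intro ω' h0 hs
      funext k
      cases k with
      | zero => exact h0.symm
      | succ k =>
        rw [consFalse_succ, ← hs, shiftSeq, add_comm]
    cases h : ω 0
    · rwa [hcons ω h rfl]
    · rw [hcons (Function.update ω 0 (!ω 0)) (by simp [h]) ?_]
      · exact hω'
      · funext k
        simp [shiftSeq]
  rw [← (hp.measurePreserving_shiftSeq 1).map_eq]
  exact (ae_map_iff (measurable_shiftSeq 1).aemeasurable hm).2 h3

lemma IsCoinMeasure.tendsto_count_zeros (hp : IsCoinMeasure p) (m : ℕ) :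
    ∀ᵐ ω ∂p, Tendsto (fun n : ℕ =>
      (Nat.count (fun j => (fun i : Fin m => ω (m * j + i)) = fun _ => false) n : ℝ) / n) atTop
      (𝓝 ((2 ^ m : ℝ)⁻¹)) := by
  have h := hp.strong_law_blocks fun v : Fin m → Bool => if v = fun _ => false then 1 else 0
  have hint : ∫ ω, (if (fun i : Fin m => ω i) = fun _ => false then (1 : ℝ) else 0) ∂p
      = (2 ^ m)⁻¹ := by
    rw [hp.integral_comp_prefix fun v : Fin m → Bool => if v = fun _ => false then (1 : ℝ) else 0]
    simp [ite_div]
  rw [hint] at h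
  filter_upwards [h] with ω hω
  refine hω.congr fun n => ?_
  rw [Finset.sum_boole, Nat.count_eq_card_filter_range]

end AlmostEvery

/-- For μ-a.e. `x ∈ (0,1)` the Fibonacci exponent of `x` exists and equals `Λ − H_μ`,
where `H_μ = lim H⁽ⁿ⁾/n` (which exists) and `Λ = log_λ 2`. -/
theorem erdos_fibonacci_exponent (p : Measure (ℕ → Bool)) (hp : IsCoinMeasure p) :
    ∃ H : ℝ, Tendsto (fun n : ℕ => Hent n / n) atTop (nhds H) ∧
      ∀ᵐ x ∂(erdosOf p), x ∈ Set.Ioo (0 : ℝ) 1 →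
        Tendsto (fun n : ℕ => Real.logb gold (wordF (digitWord n x)) / n) atTop
          (nhds (Real.logb gold 2 - H)) := by
  obtain ⟨H, hH⟩ := hp.exists_tendsto_Hent
  refine ⟨H, hH, ?_⟩
  have hmeas : MeasurableSet {x : ℝ | x ∈ Set.Ioo (0 : ℝ) 1 →
      Tendsto (fun n : ℕ => Real.logb gold (wordF (digitWord n x)) / n) atTop
        (𝓝 (Real.logb gold 2 - H))} :=
    measurableSet_Ioo.imp (measurable_greedySeq (measurableSet_tendsto_logCount _))
  rw [erdosOf, ae_map_iff measurable_piMap.aemeasurable hmeas]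
  filter_upwards [hp.tendsto_logCount_consFalse hH, hp.tendsto_count_zeros 3] with ω hω hcount hx
  refine tendsto_div_of_eq_on (A := fun n => logCount n (greedySeq (piMap ω))) (by positivity)
    (monotone_of_superadditive logCount_superadditive logCount_nonneg _) (fun i hi => ?_) hcount hω
  refine logCount_greedySeq_eq ⟨hx.1.le, hx.2⟩ (seqVal_consFalse ω) ?_ ?_ ?_ <;>
    rw [consFalse_succ]
  exacts [congrFun hi 0, congrFun hi 1, congrFun hi 2]
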